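/- For every n ≥ 1 and every f ∈ C¹_poly(ℝⁿ), the Gaussian Poincaré inequality holds: ∫ (f(x) − f̄)² dγ(x) ≤ ∫ |∇f(x)|² dγ(x), where |·| is the Euclidean norm on ℝⁿ. -/

import Mathlib

open MeasureTheory Real
open scoped RealInnerProductSpace BigOperators

noncomputable section

/-- The standard Gaussian measure on `ℝⁿ`, with density
`(2π)^(-n/2) exp(-|x|²/2)` with respect to Lebesgue measure. -/
def gaussianMeasure (n : ℕ) : Measure (EuclideanSpace ℝ (Fin n)) :=
  volume.withDensity fun x => ENNReal.ofReal ((2 * π) ^ (-(n : ℝ) / 2) * Real.exp (-‖x‖ ^ 2 / 2))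

/-- `C^k_poly(ℝⁿ)`: `C^k` functions which, together with all derivatives up to
order `k`, are bounded by a polynomial. -/
def CPoly (k n : ℕ) (f : EuclideanSpace ℝ (Fin n) → ℝ) : Prop :=
  ContDiff ℝ k f ∧
    ∀ i, i ≤ k → ∃ (C : ℝ) (m : ℕ), ∀ x, ‖iteratedFDeriv ℝ i f x‖ ≤ C * (1 + ‖x‖) ^ m

/-- The `i`-th partial derivative. -/
def partialDeriv {n : ℕ} (i : Fin n) (f : EuclideanSpace ℝ (Fin n) → ℝ)
    (x : EuclideanSpace ℝ (Fin n)) : ℝ :=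
  fderiv ℝ f x (EuclideanSpace.single i 1)

/-- The Laplacian. -/
def laplacian {n : ℕ} (f : EuclideanSpace ℝ (Fin n) → ℝ) (x : EuclideanSpace ℝ (Fin n)) : ℝ :=
  ∑ i : Fin n, partialDeriv i (partialDeriv i f) x

/-- The Ornstein–Uhlenbeck operator `δ·∇ f (x) = x·∇f(x) − Δf(x)`. -/
def ouOperator {n : ℕ} (f : EuclideanSpace ℝ (Fin n) → ℝ) (x : EuclideanSpace ℝ (Fin n)) : ℝ :=
  ⟪x, gradient f x⟫ - laplacian f x

/-- The Ornstein–Uhlenbeck semigroup given by the Mehler formula. -/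
def ouSemigroup (n : ℕ) (t : ℝ) (f : EuclideanSpace ℝ (Fin n) → ℝ)
    (x : EuclideanSpace ℝ (Fin n)) : ℝ :=
  ∫ y, f (Real.exp (-t) • x + Real.sqrt (1 - Real.exp (-2 * t)) • y) ∂gaussianMeasure n

/-- A Young function: the primitive of a continuous, strictly increasing function
`φ` with `φ(0) = 0` and `φ(u) → ∞`. -/
def IsYoung (Φ : ℝ → ℝ) : Prop :=
  ∃ φ : ℝ → ℝ, ContinuousOn φ (Set.Ici 0) ∧ StrictMonoOn φ (Set.Ici 0) ∧ φ 0 = 0 ∧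
    Filter.Tendsto φ Filter.atTop Filter.atTop ∧
    ∀ x, 0 ≤ x → Φ x = ∫ u in (0:ℝ)..x, φ u

/-- The Luxemburg norm of `f` in the Orlicz space `L_Φ(γ)` over the Gaussian space. -/
def luxNorm (n : ℕ) (Φ : ℝ → ℝ) (f : EuclideanSpace ℝ (Fin n) → ℝ) : ℝ :=
  sInf {α : ℝ | 0 < α ∧ ∫ x, Φ (|f x| / α) ∂gaussianMeasure n ≤ 1}

end

open ProbabilityTheory

/-- The density of the standard Gaussian measure on `ℝⁿ`. -/
noncomputable def gaussianDensity (n : ℕ) (x : EuclideanSpace ℝ (Fin n)) : ℝ :=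
  (2 * π) ^ (-(n : ℝ) / 2) * Real.exp (-‖x‖ ^ 2 / 2)

lemma gaussianDensity_nonneg (n : ℕ) (x : EuclideanSpace ℝ (Fin n)) : 0 ≤ gaussianDensity n x := by
  unfold gaussianDensity; positivity

lemma continuous_gaussianDensity (n : ℕ) : Continuous (gaussianDensity n) := by
  unfold gaussianDensity; fun_prop

lemma integral_gaussianMeasure {G : Type*} [NormedAddCommGroup G] [NormedSpace ℝ G] (n : ℕ)
    (h : EuclideanSpace ℝ (Fin n) → G) :
    ∫ x, h x ∂gaussianMeasure n = ∫ x, gaussianDensity n x • h x := by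
  change ∫ x, h x ∂(volume.withDensity fun x => ENNReal.ofReal (gaussianDensity n x)) = _
  rw [integral_withDensity_eq_integral_toReal_smul
    (continuous_gaussianDensity n).measurable.ennreal_ofReal (by simp)]
  simp [ENNReal.toReal_ofReal (gaussianDensity_nonneg n _)]

lemma integrable_gaussianMeasure_iff {n : ℕ} {h : EuclideanSpace ℝ (Fin n) → ℝ} :
    Integrable h (gaussianMeasure n) ↔ Integrable fun x => h x * gaussianDensity n x := by
  change Integrable h (volume.withDensity fun x => ENNReal.ofReal (gaussianDensity n x)) ↔ _
  rw [integrable_withDensity_iff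
    (continuous_gaussianDensity n).measurable.ennreal_ofReal (by simp)]
  simp [ENNReal.toReal_ofReal (gaussianDensity_nonneg n _)]

lemma hasFDerivAt_gaussianDensity (n : ℕ) (x : EuclideanSpace ℝ (Fin n)) :
    HasFDerivAt (gaussianDensity n) (-gaussianDensity n x • innerSL ℝ x) x := by
  unfold gaussianDensity
  convert! ((((hasStrictFDerivAt_norm_sq x).hasFDerivAt.neg.mul_const (2⁻¹ : ℝ)).exp).const_mul
    ((2 * π) ^ (-(n : ℝ) / 2))) using 1
  ext y
  simp [div_eq_mul_inv]
  ring

/-- The Gaussian measure given by its density is Mathlib's standard Gaussian measure. -/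
lemma gaussianMeasure_eq_stdGaussian (n : ℕ) :
    gaussianMeasure n = stdGaussian (EuclideanSpace ℝ (Fin n)) := by
  have hint : Integrable (gaussianDensity n) := by
    have h : Integrable fun x : EuclideanSpace ℝ (Fin n) => Real.exp (-(1 / 2) * ‖x‖ ^ 2) := by
      simpa [Complex.norm_exp, ← Complex.ofReal_pow] using
        (GaussianFourier.integrable_cexp_neg_mul_sq_norm_add
        (V := EuclideanSpace ℝ (Fin n)) (b := 1 / 2) (by norm_num) 0 0).norm
    refine (h.const_mul ((2 * π) ^ (-(n : ℝ) / 2))).congr (.of_forall fun x => ?_)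
    simp only [gaussianDensity]
    ring_nf
  have : IsFiniteMeasure (gaussianMeasure n) :=
    isFiniteMeasure_withDensity_ofReal hint.hasFiniteIntegral
  refine Measure.ext_of_charFun (funext fun t => ?_)
  rw [charFun_stdGaussian, charFun_apply, integral_gaussianMeasure]
  have hF := GaussianFourier.integral_cexp_neg_mul_sq_norm_add
    (V := EuclideanSpace ℝ (Fin n)) (b := 1 / 2) (by norm_num) Complex.I t
  have hpt : ∀ x : EuclideanSpace ℝ (Fin n),
      gaussianDensity n x • Complex.exp (inner ℝ x t * Complex.I) =
        ((2 * π) ^ (-(n : ℝ) / 2) : ℝ) *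
          Complex.exp (-(1 / 2) * ‖x‖ ^ 2 + Complex.I * inner ℝ t x) := fun x => by
    rw [Complex.exp_add, gaussianDensity, real_inner_comm, Complex.real_smul]
    push_cast
    rw [mul_assoc]
    ring_nf
  simp_rw [hpt]
  rw [integral_const_mul, hF, ← mul_assoc]
  have hc : (((2 * π) ^ (-(n : ℝ) / 2) : ℝ) : ℂ) *
      (π / (1 / 2)) ^ (Module.finrank ℝ (EuclideanSpace ℝ (Fin n)) / 2 : ℂ) = 1 := by
    have h2 : (π / (1 / 2) : ℂ) = ((2 * π : ℝ) : ℂ) := by push_cast; ring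
    have h3 : (Module.finrank ℝ (EuclideanSpace ℝ (Fin n)) / 2 : ℂ) = (((n : ℝ) / 2 : ℝ) : ℂ) := by
      simp
    rw [h2, h3, ← Complex.ofReal_cpow (by positivity), ← Complex.ofReal_mul,
      ← Real.rpow_add (by positivity)]
    ring_nf
    simp
  rw [hc, one_mul]
  congr 1
  rw [Complex.I_sq]
  ring

instance isGaussian_gaussianMeasure (n : ℕ) : IsGaussian (gaussianMeasure n) := by
  rw [gaussianMeasure_eq_stdGaussian]
  infer_instance

lemma map_rotation_gaussianMeasure (n : ℕ) (θ : ℝ) :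
    ((gaussianMeasure n).prod (gaussianMeasure n)).map (ContinuousLinearMap.rotation θ) =
      (gaussianMeasure n).prod (gaussianMeasure n) :=
  IsGaussian.map_rotation_eq_self (by simp [gaussianMeasure_eq_stdGaussian]) θ

/-- Gaussian integration by parts. -/
lemma integral_mul_inner_gaussianMeasure {n : ℕ} {g : EuclideanSpace ℝ (Fin n) → ℝ}
    (hg : Differentiable ℝ g) (v : EuclideanSpace ℝ (Fin n))
    (hint : Integrable g (gaussianMeasure n))
    (hint_inner : Integrable (fun z => g z * inner ℝ v z) (gaussianMeasure n))
    (hint_fderiv : Integrable (fun z => fderiv ℝ g z v) (gaussianMeasure n)) :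
    ∫ z, g z * inner ℝ v z ∂gaussianMeasure n = ∫ z, fderiv ℝ g z v ∂gaussianMeasure n := by
  rw [integrable_gaussianMeasure_iff] at hint hint_inner hint_fderiv
  have hρ : ∀ z, g z * fderiv ℝ (gaussianDensity n) z v =
      -(g z * inner ℝ v z * gaussianDensity n z) := fun z => by
    rw [(hasFDerivAt_gaussianDensity n z).fderiv, real_inner_comm]
    simp
    ring
  have h := integral_mul_fderiv_eq_neg_fderiv_mul_of_integrable hint_fderiv
    (hint_inner.neg.congr (.of_forall fun z => (hρ z).symm)) hint (fun x _ => hg x)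
    (fun x _ => (hasFDerivAt_gaussianDensity n x).differentiableAt)
  simp only [hρ, integral_neg, neg_inj] at h
  simpa only [integral_gaussianMeasure, smul_eq_mul, mul_comm (gaussianDensity n _)] using h

/-- A function whose norm is bounded by a polynomial in the norm of its argument. -/
def PolyBounded {F G : Type*} [NormedAddCommGroup F] [NormedAddCommGroup G] (h : F → G) : Prop :=
  ∃ (C : ℝ) (m : ℕ), ∀ x, ‖h x‖ ≤ C * (1 + ‖x‖) ^ m

namespace PolyBounded

variable {F G H : Type*} [NormedAddCommGroup F] [NormedAddCommGroup G] [NormedAddCommGroup H]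

lemma mono {h : F → G} {k : F → H} (hk : PolyBounded k) (hle : ∀ x, ‖h x‖ ≤ ‖k x‖) :
    PolyBounded h := by
  obtain ⟨C, m, hC⟩ := hk
  exact ⟨C, m, fun x => (hle x).trans (hC x)⟩

lemma mul {h k : F → ℝ} (hh : PolyBounded h) (hk : PolyBounded k) :
    PolyBounded fun x => h x * k x := by
  obtain ⟨C, m, hC⟩ := hh
  obtain ⟨D, l, hD⟩ := hk
  refine ⟨C * D, m + l, fun x => ?_⟩
  rw [norm_mul, pow_add, mul_mul_mul_comm]
  exact mul_le_mul (hC x) (hD x) (norm_nonneg _) ((norm_nonneg _).trans (hC x))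

lemma norm {h : F → G} (hh : PolyBounded h) : PolyBounded fun x => ‖h x‖ :=
  hh.mono fun x => by simp

lemma comp {k : G → H} {h : F → G} (hk : PolyBounded k) (hh : PolyBounded h) :
    PolyBounded fun x => k (h x) := by
  obtain ⟨C, m, hC⟩ := hh
  obtain ⟨D, l, hD⟩ := hk
  have hD0 : 0 ≤ D := by simpa using (norm_nonneg _).trans (hD 0)
  refine ⟨D * (1 + C) ^ l, m * l, fun x => (hD _).trans ?_⟩
  rw [mul_assoc, pow_mul, ← mul_pow, add_mul, one_mul]
  gcongr
  · exact one_le_pow₀ (by simp)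
  · exact hC x

lemma const (c : G) : PolyBounded fun _ : F => c := ⟨‖c‖, 0, by simp⟩

lemma id : PolyBounded fun x : F => x := ⟨1, 1, by simp⟩

lemma fst : PolyBounded fun p : F × G => p.1 := id.mono norm_fst_le

lemma snd : PolyBounded fun p : F × G => p.2 := id.mono norm_snd_le

lemma add {h k : F → G} (hh : PolyBounded h) (hk : PolyBounded k) :
    PolyBounded fun x => h x + k x := by
  obtain ⟨C, m, hC⟩ := hh
  obtain ⟨D, l, hD⟩ := hk
  have hC0 : 0 ≤ C := by simpa using (norm_nonneg _).trans (hC 0)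
  have hD0 : 0 ≤ D := by simpa using (norm_nonneg _).trans (hD 0)
  refine ⟨C + D, m + l, fun x => (norm_add_le _ _).trans ?_⟩
  have hx : 1 ≤ 1 + ‖x‖ := by simp
  rw [add_mul]
  refine add_le_add ((hC x).trans ?_) ((hD x).trans ?_) <;> gcongr <;> first | exact hx | omega

lemma clm [NormedSpace ℝ F] [NormedSpace ℝ G] (L : F →L[ℝ] G) : PolyBounded fun x => L x :=
  ⟨‖L‖, 1, fun x => by
    rw [pow_one]
    exact (L.le_opNorm x).trans (by gcongr; simp)⟩

lemma clm_apply [NormedSpace ℝ G] [NormedSpace ℝ H] {L : F → G →L[ℝ] H} {v : F → G}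
    (hL : PolyBounded L) (hv : PolyBounded v) : PolyBounded fun x => L x (v x) :=
  (hL.norm.mul hv.norm).mono fun x => by
    simpa using (L x).le_opNorm (v x)

lemma integrable [NormedSpace ℝ F] [MeasurableSpace F] [BorelSpace F] [CompleteSpace F]
    [SecondCountableTopology F] {μ : Measure F} [IsGaussian μ] {h : F → ℝ}
    (hh : PolyBounded h) (hcont : Continuous h) : Integrable h μ := by
  obtain ⟨C, m, hC⟩ := hh
  refine Integrable.mono' (g := fun x => C * (1 + ‖x‖) ^ m) (.const_mul ?_ C)
    hcont.aestronglyMeasurable (.of_forall hC)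
  have h0 : MemLp (fun x : F => ‖x‖) m μ := (IsGaussian.memLp_id μ m (by simp)).norm
  have h1 : MemLp (fun x : F => 1 + ‖x‖) m μ := (memLp_const (1 : ℝ)).add h0
  refine h1.integrable_norm_pow'.congr (.of_forall fun x => ?_)
  simp only [Real.norm_eq_abs]
  rw [abs_of_nonneg (by positivity)]

end PolyBounded

section

variable {n : ℕ} {f : EuclideanSpace ℝ (Fin n) → ℝ}

lemma CPoly.polyBounded {k : ℕ} (hf : CPoly k n f) : PolyBounded f := by
  obtain ⟨C, m, h⟩ := hf.2 0 (Nat.zero_le _)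
  exact ⟨C, m, fun x => by simpa using h x⟩

lemma CPoly.polyBounded_fderiv (hf : CPoly 1 n f) : PolyBounded (fderiv ℝ f) := by
  obtain ⟨C, m, h⟩ := hf.2 1 le_rfl
  exact ⟨C, m, fun x => by simpa [norm_iteratedFDeriv_one] using h x⟩

lemma CPoly.continuous_fderiv (hf : CPoly 1 n f) : Continuous (fderiv ℝ f) :=
  hf.1.continuous_fderiv (by simp)

lemma CPoly.differentiable (hf : CPoly 1 n f) : Differentiable ℝ f :=
  hf.1.differentiable (by simp)

lemma norm_gradient (x : EuclideanSpace ℝ (Fin n)) : ‖gradient f x‖ = ‖fderiv ℝ f x‖ := by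
  simp [gradient]

lemma CPoly.continuous_gradient (hf : CPoly 1 n f) : Continuous (gradient f) :=
  (InnerProductSpace.toDual ℝ _).symm.continuous.comp hf.continuous_fderiv

lemma CPoly.polyBounded_gradient (hf : CPoly 1 n f) : PolyBounded (gradient f) :=
  hf.polyBounded_fderiv.mono fun x => (norm_gradient x).le

lemma integral_comp_rotation (θ : ℝ)
    {h : EuclideanSpace ℝ (Fin n) × EuclideanSpace ℝ (Fin n) → ℝ} (hh : Continuous h) :
    ∫ p, h (ContinuousLinearMap.rotation θ p) ∂(gaussianMeasure n).prod (gaussianMeasure n) =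
      ∫ p, h p ∂(gaussianMeasure n).prod (gaussianMeasure n) := by
  conv_rhs => rw [← map_rotation_gaussianMeasure n θ]
  rw [integral_map (by fun_prop) hh.aestronglyMeasurable]

lemma integral_comp_fst_gaussianMeasure (h : EuclideanSpace ℝ (Fin n) → ℝ) :
    ∫ p, h p.1 ∂(gaussianMeasure n).prod (gaussianMeasure n) = ∫ x, h x ∂gaussianMeasure n := by
  simpa using integral_fun_fst (μ := gaussianMeasure n) (ν := gaussianMeasure n) h

/-- Integration by parts along the rotation: the correlation of `f` with the derivative of its
rotated copy is a correlation of gradients. -/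
lemma integral_mul_fderiv_rotation (hf : CPoly 1 n f) (θ : ℝ) :
    ∫ p : EuclideanSpace ℝ (Fin n) × EuclideanSpace ℝ (Fin n),
      f p.1 * fderiv ℝ f (ContinuousLinearMap.rotation θ p).1
        (ContinuousLinearMap.rotation θ p).2 ∂(gaussianMeasure n).prod (gaussianMeasure n) =
    ∫ q : EuclideanSpace ℝ (Fin n) × EuclideanSpace ℝ (Fin n),
      -sin θ * inner ℝ (gradient f (ContinuousLinearMap.rotation (-θ) q).1) (gradient f q.1)
        ∂(gaussianMeasure n).prod (gaussianMeasure n) := by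
  have hfc : Continuous f := hf.1.continuous
  have hf'c := hf.continuous_fderiv
  have hgc := hf.continuous_gradient
  have hfst : PolyBounded fun q : EuclideanSpace ℝ (Fin n) × EuclideanSpace ℝ (Fin n) => q.1 :=
    .fst
  have hsnd : PolyBounded fun q : EuclideanSpace ℝ (Fin n) × EuclideanSpace ℝ (Fin n) => q.2 :=
    .snd
  have hrot : PolyBounded fun q : EuclideanSpace ℝ (Fin n) × EuclideanSpace ℝ (Fin n) =>
      (ContinuousLinearMap.rotation (-θ) q).1 := hfst.comp (.clm _)
  have hinv (p : EuclideanSpace ℝ (Fin n) × EuclideanSpace ℝ (Fin n)) :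
      (ContinuousLinearMap.rotation (-θ) (ContinuousLinearMap.rotation θ p)).1 = p.1 := by
    simp only [ContinuousLinearMap.rotation_apply, cos_neg, sin_neg]
    linear_combination (norm := module) (sin_sq_add_cos_sq θ) • p.1
  have hstep := integral_comp_rotation θ
    (h := fun q : EuclideanSpace ℝ (Fin n) × EuclideanSpace ℝ (Fin n) =>
      f (ContinuousLinearMap.rotation (-θ) q).1 * fderiv ℝ f q.1 q.2) (by fun_prop)
  simp only [hinv] at hstep
  rw [hstep, integral_prod, integral_prod]
  · congr 1 with u
    let g : EuclideanSpace ℝ (Fin n) → ℝ := fun z => f (ContinuousLinearMap.rotation (-θ) (u, z)).1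
    have hder (z : EuclideanSpace ℝ (Fin n)) : HasFDerivAt g
        (-sin θ • fderiv ℝ f (ContinuousLinearMap.rotation (-θ) (u, z)).1) z := by
      have hin : HasFDerivAt (fun z => (ContinuousLinearMap.rotation (-θ) (u, z)).1)
          (-sin θ • ContinuousLinearMap.id ℝ (EuclideanSpace ℝ (Fin n))) z := by
        simp only [ContinuousLinearMap.rotation_apply, sin_neg]
        exact ((hasFDerivAt_id z).const_smul (-sin θ)).const_add _
      convert! (hf.differentiable _).hasFDerivAt.comp z hin using 1
      ext v
      simp
    have hpair : PolyBounded fun z : EuclideanSpace ℝ (Fin n) => (u, z) :=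
      ((PolyBounded.const ‖u‖).add PolyBounded.id.norm).mono fun z => by
        rw [Real.norm_eq_abs, abs_of_nonneg (by positivity), Prod.norm_def]
        exact max_le_add_of_nonneg (norm_nonneg _) (norm_nonneg _)
    have hgP : PolyBounded g := hf.polyBounded.comp (hrot.comp hpair)
    have hgc' : Continuous g := by fun_prop
    have hibp := integral_mul_inner_gaussianMeasure (g := g)
      (fun z => (hder z).differentiableAt) (gradient f u)
      (hgP.integrable hgc')
      ((hgP.mul (.clm (innerSL ℝ (gradient f u)))).integrable (by fun_prop)) ?_
    · simp only [inner_gradient_left, (hder _).fderiv, smul_apply,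
        smul_eq_mul] at hibp ⊢
      exact hibp
    · simp only [(hder _).fderiv]
      refine PolyBounded.integrable ?_ (by fun_prop)
      exact (PolyBounded.const (-sin θ)).mul
        ((hf.polyBounded_fderiv.comp (hrot.comp hpair)).clm_apply (.const _))
  · refine PolyBounded.integrable ?_ (by fun_prop)
    simp only [inner_gradient_left]
    exact (PolyBounded.const _).mul
      ((hf.polyBounded_fderiv.comp hrot).clm_apply (hf.polyBounded_gradient.comp hfst))
  · refine PolyBounded.integrable ?_ (by fun_prop)
    exact (hf.polyBounded.comp hrot).mul ((hf.polyBounded_fderiv.comp hfst).clm_apply hsnd)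

lemma neg_sin_mul_le_integral_mul_fderiv_rotation (hf : CPoly 1 n f) {θ : ℝ} (hθ : 0 ≤ sin θ) :
    -sin θ * ∫ x, ‖gradient f x‖ ^ 2 ∂gaussianMeasure n ≤
    ∫ p : EuclideanSpace ℝ (Fin n) × EuclideanSpace ℝ (Fin n),
      f p.1 * fderiv ℝ f (ContinuousLinearMap.rotation θ p).1
        (ContinuousLinearMap.rotation θ p).2 ∂(gaussianMeasure n).prod (gaussianMeasure n) := by
  have hgc := hf.continuous_gradient
  have hfst : PolyBounded fun q : EuclideanSpace ℝ (Fin n) × EuclideanSpace ℝ (Fin n) => q.1 :=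
    .fst
  have hrot : PolyBounded fun q : EuclideanSpace ℝ (Fin n) × EuclideanSpace ℝ (Fin n) =>
      (ContinuousLinearMap.rotation (-θ) q).1 := hfst.comp (.clm _)
  have hsq : PolyBounded fun x => ‖gradient f x‖ ^ 2 := by
    simpa only [sq] using hf.polyBounded_gradient.norm.mul hf.polyBounded_gradient.norm
  have hint1 : Integrable (fun q : EuclideanSpace ℝ (Fin n) × EuclideanSpace ℝ (Fin n) =>
      ‖gradient f q.1‖ ^ 2) ((gaussianMeasure n).prod (gaussianMeasure n)) :=
    (hsq.comp hfst).integrable (by fun_prop)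
  have hint2 : Integrable (fun q : EuclideanSpace ℝ (Fin n) × EuclideanSpace ℝ (Fin n) =>
      ‖gradient f (ContinuousLinearMap.rotation (-θ) q).1‖ ^ 2)
        ((gaussianMeasure n).prod (gaussianMeasure n)) :=
    (hsq.comp hrot).integrable (by fun_prop)
  have hint3 : Integrable (fun q : EuclideanSpace ℝ (Fin n) × EuclideanSpace ℝ (Fin n) =>
      inner ℝ (gradient f (ContinuousLinearMap.rotation (-θ) q).1) (gradient f q.1))
        ((gaussianMeasure n).prod (gaussianMeasure n)) := by
    refine PolyBounded.integrable ?_ (by fun_prop)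
    simp only [inner_gradient_left]
    exact (hf.polyBounded_fderiv.comp hrot).clm_apply (hf.polyBounded_gradient.comp hfst)
  have hinner : ∫ q, inner ℝ (gradient f (ContinuousLinearMap.rotation (-θ) q).1) (gradient f q.1)
        ∂(gaussianMeasure n).prod (gaussianMeasure n) ≤
      ∫ x, ‖gradient f x‖ ^ 2 ∂gaussianMeasure n := by
    calc
      _ ≤ ∫ q, (‖gradient f (ContinuousLinearMap.rotation (-θ) q).1‖ ^ 2 +
            ‖gradient f q.1‖ ^ 2) / 2 ∂(gaussianMeasure n).prod (gaussianMeasure n) := by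
        refine integral_mono hint3 ((hint2.add hint1).div_const 2) fun q => ?_
        have := real_inner_le_norm (gradient f (ContinuousLinearMap.rotation (-θ) q).1)
          (gradient f q.1)
        have := two_mul_le_add_sq ‖gradient f (ContinuousLinearMap.rotation (-θ) q).1‖
          ‖gradient f q.1‖
        simp only
        linarith
      _ = _ := by
        rw [integral_div, integral_add hint2 hint1,
          integral_comp_rotation (-θ) (h := fun q => ‖gradient f q.1‖ ^ 2) (by fun_prop),
          integral_comp_fst_gaussianMeasure (fun x => ‖gradient f x‖ ^ 2)]
        ring
  rw [integral_mul_fderiv_rotation hf, integral_const_mul]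
  exact mul_le_mul_of_nonpos_left hinner (neg_nonpos.2 hθ)

/-- Differentiation of the correlation of `f` with its rotated copy. -/
lemma hasDerivAt_integral_mul_rotation (hf : CPoly 1 n f) (θ : ℝ) :
    HasDerivAt (fun θ => ∫ p : EuclideanSpace ℝ (Fin n) × EuclideanSpace ℝ (Fin n),
      f p.1 * f (ContinuousLinearMap.rotation θ p).1 ∂(gaussianMeasure n).prod (gaussianMeasure n))
    (∫ p : EuclideanSpace ℝ (Fin n) × EuclideanSpace ℝ (Fin n),
      f p.1 * fderiv ℝ f (ContinuousLinearMap.rotation θ p).1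
        (ContinuousLinearMap.rotation θ p).2 ∂(gaussianMeasure n).prod (gaussianMeasure n)) θ := by
  have hfc : Continuous f := hf.1.continuous
  have hf'c := hf.continuous_fderiv
  have hfst : PolyBounded fun q : EuclideanSpace ℝ (Fin n) × EuclideanSpace ℝ (Fin n) => q.1 :=
    .fst
  obtain ⟨C, m, hC⟩ := hf.polyBounded_fderiv
  have hC0 : 0 ≤ C := by simpa using (norm_nonneg _).trans (hC 0)
  have hnorm (a b : ℝ) (ha : |a| ≤ 1) (hb : |b| ≤ 1)
      (p : EuclideanSpace ℝ (Fin n) × EuclideanSpace ℝ (Fin n)) :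
      ‖a • p.1 + b • p.2‖ ≤ ‖p‖ + ‖p‖ := by
    refine (norm_add_le _ _).trans ?_
    rw [norm_smul, norm_smul, Real.norm_eq_abs, Real.norm_eq_abs]
    exact add_le_add
      ((mul_le_of_le_one_left (norm_nonneg _) ha).trans (norm_fst_le p))
      ((mul_le_of_le_one_left (norm_nonneg _) hb).trans (norm_snd_le p))
  refine (hasDerivAt_integral_of_dominated_loc_of_deriv_le
    (F := fun θ p => f p.1 * f (ContinuousLinearMap.rotation θ p).1)
    (F' := fun θ p => f p.1 * fderiv ℝ f (ContinuousLinearMap.rotation θ p).1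
        (ContinuousLinearMap.rotation θ p).2)
    (bound := fun p => ‖f p.1‖ * (C * (1 + (‖p‖ + ‖p‖)) ^ m * (‖p‖ + ‖p‖))) Filter.univ_mem
    (.of_forall fun θ => Continuous.aestronglyMeasurable (by fun_prop)) ?_
    (Continuous.aestronglyMeasurable (by fun_prop)) (.of_forall fun p θ _ => ?_) ?_
    (.of_forall fun p θ _ => ?_)).2
  · exact ((hf.polyBounded.comp hfst).mul
      (hf.polyBounded.comp (hfst.comp (.clm _)))).integrable (by fun_prop)
  · rw [norm_mul]
    have h1 := hnorm _ _ (abs_cos_le_one θ) (abs_sin_le_one θ) p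
    have h2 := hnorm (-sin θ) _ (by simpa using abs_sin_le_one θ) (abs_cos_le_one θ) p
    gcongr
    refine (ContinuousLinearMap.le_opNorm _ _).trans ?_
    refine mul_le_mul ((hC _).trans ?_) h2 (norm_nonneg _) (by positivity)
    gcongr
    exact h1
  · refine PolyBounded.integrable ?_ (by fun_prop)
    have hd : PolyBounded fun p : EuclideanSpace ℝ (Fin n) × EuclideanSpace ℝ (Fin n) =>
        ‖p‖ + ‖p‖ := PolyBounded.id.norm.add PolyBounded.id.norm
    have hp : PolyBounded fun r : ℝ => C * (1 + r) ^ m :=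
      ⟨C, m, fun r => by
        rw [norm_mul, norm_pow, Real.norm_of_nonneg hC0]
        gcongr
        simpa using norm_add_le 1 r⟩
    exact (hf.polyBounded.comp hfst).norm.mul ((hp.comp hd).mul hd)
  · refine HasDerivAt.const_mul _ ?_
    refine (hf.differentiable _).hasFDerivAt.comp_hasDerivAt θ ?_
    simp only [ContinuousLinearMap.rotation_apply]
    exact ((hasDerivAt_cos θ).smul_const p.1).add ((hasDerivAt_sin θ).smul_const p.2)

end


/-- **Gaussian Poincaré inequality.** For every `n ≥ 1` and `f ∈ C¹_poly(ℝⁿ)`,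
`∫ (f − f̄)² dγ ≤ ∫ |∇f|² dγ`. -/
theorem gaussian_poincare (n : ℕ) (hn : 1 ≤ n) (f : EuclideanSpace ℝ (Fin n) → ℝ)
    (hf : CPoly 1 n f) :
    ∫ x, (f x - ∫ y, f y ∂gaussianMeasure n) ^ 2 ∂gaussianMeasure n ≤
      ∫ x, ‖gradient f x‖ ^ 2 ∂gaussianMeasure n := by
  have hfc : Continuous f := hf.1.continuous
  have hfint : Integrable f (gaussianMeasure n) := hf.polyBounded.integrable hfc
  have hffint : Integrable (fun x => f x * f x) (gaussianMeasure n) :=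
    (hf.polyBounded.mul hf.polyBounded).integrable (by fun_prop)
  set A := ∫ x, ‖gradient f x‖ ^ 2 ∂gaussianMeasure n
  set ψ : ℝ → ℝ := fun θ => ∫ p : EuclideanSpace ℝ (Fin n) × EuclideanSpace ℝ (Fin n),
    f p.1 * f (ContinuousLinearMap.rotation θ p).1 ∂(gaussianMeasure n).prod (gaussianMeasure n)
  have hderiv (θ : ℝ) := (hasDerivAt_integral_mul_rotation hf θ).sub
    ((hasDerivAt_cos θ).mul_const A)
  have hmono : MonotoneOn (fun θ => ψ θ - cos θ * A) (Set.Icc 0 (π / 2)) := by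
    refine monotoneOn_of_deriv_nonneg (convex_Icc _ _)
      (fun θ _ => (hderiv θ).continuousAt.continuousWithinAt)
      (fun θ _ => (hderiv θ).differentiableAt.differentiableWithinAt) fun θ hθ => ?_
    rw [interior_Icc] at hθ
    have hsin : 0 ≤ sin θ := sin_nonneg_of_nonneg_of_le_pi hθ.1.le (by linarith [hθ.2, pi_pos])
    refine ((hderiv θ).deriv).symm ▸ ?_
    linarith [neg_sin_mul_le_integral_mul_fderiv_rotation hf hsin]
  have hle := hmono (Set.left_mem_Icc.2 (by positivity)) (Set.right_mem_Icc.2 (by positivity))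
    (by positivity)
  have h0 : ψ 0 = ∫ x, f x * f x ∂gaussianMeasure n := by
    simpa [ψ, ContinuousLinearMap.rotation_apply] using
      integral_comp_fst_gaussianMeasure (fun x => f x * f x)
  have h1 : ψ (π / 2) = (∫ x, f x ∂gaussianMeasure n) * ∫ x, f x ∂gaussianMeasure n := by
    simpa [ψ, ContinuousLinearMap.rotation_apply] using
      integral_prod_mul (μ := gaussianMeasure n) (ν := gaussianMeasure n) f f
  simp only [h0, h1, cos_zero, cos_pi_div_two] at hle
  set a := ∫ x, f x ∂gaussianMeasure n with ha
  have hvar : ∫ x, (f x - a) ^ 2 ∂gaussianMeasure n =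
      ∫ x, f x * f x ∂gaussianMeasure n - a * a := by
    have hpt : ∀ x, (f x - a) ^ 2 = f x * f x - 2 * a * f x + a * a := fun x => by ring
    have hsub : Integrable (fun x => f x * f x - 2 * a * f x) (gaussianMeasure n) :=
      hffint.sub (hfint.const_mul _)
    simp_rw [hpt]
    rw [integral_add hsub (integrable_const _),
      integral_sub hffint (hfint.const_mul _), integral_const_mul, ← ha]
    simp
    ring
  linarith
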